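/- There is a function g : ℕ × ℕ → ℕ (one may take g(q,N) = 2^{2q−2}·max(1536(q²+1), 2N+3072) − 6144) with the following property. Let q ≥ 2 and N ≥ 2 be integers, D a strongly connected digraph, and Z₁, Z₂ ⊆ A(D) with μ(D,Z₁,Z₂) ≥ g(q,N). Then there exists X ⊆ V(D) such that (i) μ(D[X],Z₁,Z₂) ≥ N, and (ii) for every pair (u,v) of distinct vertices of X and every triple (a,b,ℓ) of integers with gcd(a,q) = gcd(b,q) = 1, there exists a directed X-path Q in D from u to v satisfying a·|A(Q)∩Z₁| + b·|A(Q)∩Z₂| ≡ ℓ (mod q). -/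

import Mathlib

variable {V : Type}

/-- The arcs of a directed cycle given by its (cyclic) vertex list. -/
def cycleArcs (vs : List V) : List (V × V) := vs.zip (vs.rotate 1)

/-- The arcs of a directed path given by its vertex list. -/
def pathArcs (vs : List V) : List (V × V) := vs.zip vs.tail

/-- `vs` is the vertex list of a directed cycle in the digraph `D`. -/
def IsDicycle (D : V → V → Prop) (vs : List V) : Prop :=
  vs ≠ [] ∧ vs.Nodup ∧ ∀ p ∈ cycleArcs vs, D p.1 p.2

/-- The number of (distinct) arcs of `l` that lie in `Z`. -/
noncomputable def arcCount (l : List (V × V)) (Z : Set (V × V)) : ℕ :=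
  Nat.card {a : V × V // a ∈ l ∧ a ∈ Z}

/-- The directed cycle `vs` is `(Z1, Z2)`-unbalanced. -/
def Unbalanced (Z1 Z2 : Set (V × V)) (vs : List V) : Prop :=
  arcCount (cycleArcs vs) Z1 ≠ arcCount (cycleArcs vs) Z2

/-- The induced subdigraph `D[S]` contains no `(Z1,Z2)`-unbalanced directed cycle. -/
def NoUnbCycle (D : V → V → Prop) (Z1 Z2 : Set (V × V)) (S : Set V) : Prop :=
  ∀ vs : List V, IsDicycle D vs → (∀ v ∈ vs, v ∈ S) → ¬ Unbalanced Z1 Z2 vs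

/-- `mu D Z1 Z2 S` is the `(Z1,Z2)`-unbalanced dichromatic number of the induced
subdigraph `D[S]`: the least number of parts of a partition of `S` each of whose
parts induces no `(Z1,Z2)`-unbalanced directed cycle. -/
noncomputable def mu (D : V → V → Prop) (Z1 Z2 : Set (V × V)) (S : Set V) : ℕ :=
  sInf {k | ∃ c : V → Fin k, ∀ i : Fin k, NoUnbCycle D Z1 Z2 (S ∩ {v | c v = i})}

/-- The adjacency relation of the induced subdigraph `D[S]`. -/
def inducedRel (D : V → V → Prop) (S : Set V) : V → V → Prop :=
  fun u v => D u v ∧ u ∈ S ∧ v ∈ S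

/-- The induced subdigraph `D[S]` is strongly connected. -/
def StronglyConnectedOn (D : V → V → Prop) (S : Set V) : Prop :=
  ∀ u ∈ S, ∀ v ∈ S, Relation.ReflTransGen (inducedRel D S) u v

/-- `H` is (the vertex set of) a strong component of the induced subdigraph `D[S]`. -/
def IsStrongComponent (D : V → V → Prop) (S H : Set V) : Prop :=
  H ⊆ S ∧ H.Nonempty ∧ StronglyConnectedOn D H ∧
    ∀ H', H ⊆ H' → H' ⊆ S → StronglyConnectedOn D H' → H' = H

/-- `vs` is the vertex list of a directed path in `D`. -/
def IsDipath (D : V → V → Prop) (vs : List V) : Prop :=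
  vs.Nodup ∧ vs.Chain' D

/-- `vs` is a directed path in `D` from `x` to `y`. -/
def IsDipathFromTo (D : V → V → Prop) (vs : List V) (x y : V) : Prop :=
  IsDipath D vs ∧ vs.head? = some x ∧ vs.getLast? = some y

/-- The internal vertices of a path given by its vertex list. -/
def internalVerts (vs : List V) : List V := vs.tail.dropLast

/-- `vs` is a directed `X`-path in `D` from `x` to `y`: a directed path whose two
endpoints are distinct vertices of `X` and whose internal vertices avoid `X`. -/
def IsXPath (D : V → V → Prop) (X : Set V) (vs : List V) (x y : V) : Prop :=
  IsDipathFromTo D vs x y ∧ x ∈ X ∧ y ∈ X ∧ x ≠ y ∧ ∀ v ∈ internalVerts vs, v ∉ X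
section UnbalancedColouring

/-- `D[S]` splits into `m` parts without `(Z1,Z2)`-unbalanced directed cycles. -/
def UnbColorable (D : V → V → Prop) (Z1 Z2 : Set (V × V)) (S : Set V) (m : ℕ) : Prop :=
  ∃ c : V → Fin m, ∀ i : Fin m, NoUnbCycle D Z1 Z2 (S ∩ {v | c v = i})

theorem NoUnbCycle.subset {D : V → V → Prop} {Z1 Z2 : Set (V × V)} {S T : Set V}
    (h : NoUnbCycle D Z1 Z2 T) (hST : S ⊆ T) : NoUnbCycle D Z1 Z2 S :=
  fun vs hvs hS => h vs hvs fun v hv => hST (hS v hv)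

theorem UnbColorable.subset {D : V → V → Prop} {Z1 Z2 : Set (V × V)} {S T : Set V} {m : ℕ}
    (h : UnbColorable D Z1 Z2 T m) (hST : S ⊆ T) : UnbColorable D Z1 Z2 S m := by
  obtain ⟨c, hc⟩ := h
  exact ⟨c, fun i => (hc i).subset (Set.inter_subset_inter_left _ hST)⟩

theorem unbColorable_of_coloring {D : V → V → Prop} {Z1 Z2 : Set (V × V)} {S : Set V}
    {α : Type*} [Fintype α] (c : V → α) (hc : ∀ i, NoUnbCycle D Z1 Z2 (S ∩ {v | c v = i}))
    {m : ℕ} (hm : Fintype.card α ≤ m) : UnbColorable D Z1 Z2 S m := by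
  obtain ⟨e⟩ : Nonempty (α ↪ Fin m) :=
    Function.Embedding.nonempty_of_card_le (by simpa using hm)
  refine ⟨fun v => e (c v), fun i vs hvs hS => ?_⟩
  obtain ⟨x, hx⟩ := List.exists_mem_of_ne_nil vs hvs.1
  refine hc (c x) vs hvs fun v hv => ⟨(hS v hv).1, e.injective ?_⟩
  exact (hS v hv).2.trans (hS x hx).2.symm

theorem UnbColorable.mono {D : V → V → Prop} {Z1 Z2 : Set (V × V)} {S : Set V} {m n : ℕ}
    (h : UnbColorable D Z1 Z2 S m) (hmn : m ≤ n) : UnbColorable D Z1 Z2 S n := by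
  obtain ⟨c, hc⟩ := h
  exact unbColorable_of_coloring c hc (by simpa using hmn)

theorem unbColorable_empty (D : V → V → Prop) (Z1 Z2 : Set (V × V)) {m : ℕ} (hm : 1 ≤ m) :
    UnbColorable D Z1 Z2 ∅ m := by
  refine ⟨fun _ => ⟨0, hm⟩, fun i vs hvs hS => ?_⟩
  obtain ⟨x, hx⟩ := List.exists_mem_of_ne_nil vs hvs.1
  exact absurd (hS x hx).1 (Set.notMem_empty x)

theorem UnbColorable.union {D : V → V → Prop} {Z1 Z2 : Set (V × V)} {S T : Set V} {m n : ℕ}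
    (hS : UnbColorable D Z1 Z2 S m) (hT : UnbColorable D Z1 Z2 T n) :
    UnbColorable D Z1 Z2 (S ∪ T) (m + n) := by
  classical
  obtain ⟨c, hc⟩ := hS
  obtain ⟨c', hc'⟩ := hT
  refine unbColorable_of_coloring (α := Fin m ⊕ Fin n)
    (fun v => if v ∈ S then Sum.inl (c v) else Sum.inr (c' v)) ?_ (by simp)
  rintro (i | i)
  · refine (hc i).subset fun v hv => ?_
    by_cases hvS : v ∈ S <;> simp_all
  · refine (hc' i).subset fun v hv => ?_
    by_cases hvS : v ∈ S <;> simp_all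

/-- Colourings of the classes of a labelling that is constant on directed cycles glue. -/
theorem unbColorable_glue {D : V → V → Prop} {Z1 Z2 : Set (V × V)} {S : Set V} {m : ℕ}
    {ι : Type*} (κ : V → ι) (hκ : ∀ x ∈ S, UnbColorable D Z1 Z2 (S ∩ {v | κ v = κ x}) m)
    (hm : 1 ≤ m)
    (hcyc : ∀ vs, IsDicycle D vs → (∀ v ∈ vs, v ∈ S) → ∀ x ∈ vs, ∀ y ∈ vs, κ x = κ y) :
    UnbColorable D Z1 Z2 S m := by
  have hκ' : ∀ i : ι, UnbColorable D Z1 Z2 (S ∩ {v | κ v = i}) m := by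
    intro i
    by_cases h : ∃ x ∈ S, κ x = i
    · obtain ⟨x, hx, rfl⟩ := h
      exact hκ x hx
    · refine (unbColorable_empty D Z1 Z2 hm).subset fun v hv => h ⟨v, hv⟩
  choose c hc using hκ'
  refine ⟨fun v => c (κ v) v, fun i vs hvs hS => ?_⟩
  obtain ⟨x, hx⟩ := List.exists_mem_of_ne_nil vs hvs.1
  have hconst := hcyc vs hvs fun v hv => (hS v hv).1
  refine hc (κ x) i vs hvs fun v hv => ⟨⟨(hS v hv).1, hconst v hv x hx⟩, ?_⟩
  have h : c (κ v) v = i := (hS v hv).2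
  rw [hconst v hv x hx] at h
  exact h

theorem cycleArcs_getElem {vs : List V} {i : ℕ} (hi : i + 1 < vs.length) :
    (vs[i], vs[i + 1]) ∈ cycleArcs vs := by
  rw [cycleArcs, List.mem_iff_getElem]
  refine ⟨i, by simp; omega, ?_⟩
  simp [List.getElem_rotate, Nat.mod_eq_of_lt hi]

theorem cycleArcs_getElem_last {vs : List V} (h : 0 < vs.length) :
    (vs[vs.length - 1], vs[0]) ∈ cycleArcs vs := by
  rw [cycleArcs, List.mem_iff_getElem]
  refine ⟨vs.length - 1, by simp; omega, ?_⟩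
  have : (vs.length - 1 + 1) % vs.length = 0 := by
    rw [Nat.sub_add_cancel h, Nat.mod_self]
  simp [List.getElem_rotate, this]

theorem mem_of_mem_cycleArcs {vs : List V} {p : V × V} (hp : p ∈ cycleArcs vs) :
    p.1 ∈ vs ∧ p.2 ∈ vs := by
  have h : (p.1, p.2) ∈ vs.zip (vs.rotate 1) := hp
  exact ⟨(List.of_mem_zip h).1, List.mem_rotate.1 (List.of_mem_zip h).2⟩

theorem cycleArcs_connected {vs : List V} {x y : V} (hx : x ∈ vs) (hy : y ∈ vs) :
    Relation.ReflTransGen (fun a b => (a, b) ∈ cycleArcs vs) x y := by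
  have hpos : 0 < vs.length := List.length_pos_of_mem hx
  have from_zero : ∀ i (hi : i < vs.length),
      Relation.ReflTransGen (fun a b => (a, b) ∈ cycleArcs vs) vs[0] vs[i] := by
    intro i
    induction i with
    | zero => intro _; exact .refl
    | succ i ih => intro hi; exact (ih (by omega)).tail (cycleArcs_getElem hi)
  have to_last : ∀ j i (hi : i < vs.length), i + j = vs.length - 1 →
      Relation.ReflTransGen (fun a b => (a, b) ∈ cycleArcs vs) vs[i] vs[vs.length - 1] := by
    intro j
    induction j with
    | zero => intro i hi h; simp only [Nat.add_zero] at h; subst h; exact .refl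
    | succ j ih =>
      intro i hi h
      exact (ih (i + 1) (by omega) (by omega)).head (cycleArcs_getElem (by omega))
  obtain ⟨i, hi, rfl⟩ := List.mem_iff_getElem.1 hx
  obtain ⟨j, hj, rfl⟩ := List.mem_iff_getElem.1 hy
  exact ((to_last (vs.length - 1 - i) i hi (by omega)).tail
    (cycleArcs_getElem_last hpos)).trans (from_zero j hj)

theorem eq_of_antitone_on_cycle {vs : List V} {α : Type*} [PartialOrder α] {f : V → α}
    (hf : ∀ p ∈ cycleArcs vs, f p.2 ≤ f p.1) {x y : V} (hx : x ∈ vs) (hy : y ∈ vs) :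
    f x = f y := by
  have key : ∀ a b, Relation.ReflTransGen (fun a b => (a, b) ∈ cycleArcs vs) a b →
      f b ≤ f a := by
    intro a b h
    induction h with
    | refl => exact le_rfl
    | tail _ h ih => exact (hf _ h).trans ih
  exact le_antisymm (key _ _ (cycleArcs_connected hy hx)) (key _ _ (cycleArcs_connected hx hy))

/-- If every arc of `D[S]` increases `d` by at most one, or every arc decreases `d` by at
most one, then some level of `d` has at least half the unbalanced dichromatic number. -/
theorem exists_level_not_unbColorable {D : V → V → Prop} {Z1 Z2 : Set (V × V)} {S : Set V}
    {d : V → ℕ} {m : ℕ} (hm : 1 ≤ m)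
    (hd : (∀ u ∈ S, ∀ v ∈ S, D u v → d v ≤ d u + 1) ∨
      ∀ u ∈ S, ∀ v ∈ S, D u v → d u ≤ d v + 1)
    (hS : ¬ UnbColorable D Z1 Z2 S (2 * m)) :
    ∃ j, ¬ UnbColorable D Z1 Z2 (S ∩ {v | d v = j}) m := by
  by_contra! h
  have parity : ∀ r : ℕ, UnbColorable D Z1 Z2 (S ∩ {v | d v % 2 = r}) m := by
    intro r
    refine unbColorable_glue d (fun x _ => (h (d x)).subset fun v hv => ⟨hv.1.1, hv.2⟩) hm ?_
    intro vs hvs hvS x hx y hy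
    rcases hd with hd | hd
    · refine eq_of_antitone_on_cycle (fun p hp => ?_) hx hy
      obtain ⟨h1, h2⟩ := mem_of_mem_cycleArcs hp
      have h3 := hd _ (hvS _ h1).1 _ (hvS _ h2).1 (hvs.2.2 p hp)
      have h4 : d p.1 % 2 = r := (hvS _ h1).2
      have h5 : d p.2 % 2 = r := (hvS _ h2).2
      omega
    · refine eq_of_antitone_on_cycle (α := ℕᵒᵈ) (f := fun v => OrderDual.toDual (d v))
        (fun p hp => ?_) hx hy
      obtain ⟨h1, h2⟩ := mem_of_mem_cycleArcs hp
      have h3 := hd _ (hvS _ h1).1 _ (hvS _ h2).1 (hvs.2.2 p hp)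
      have h4 : d p.1 % 2 = r := (hvS _ h1).2
      have h5 : d p.2 % 2 = r := (hvS _ h2).2
      exact OrderDual.toDual_le_toDual.2 (by omega)
  refine hS ?_
  rw [two_mul]
  refine ((parity 0).union (parity 1)).subset fun v hv => ?_
  rcases Nat.mod_two_eq_zero_or_one (d v) with h0 | h1
  · exact Or.inl ⟨hv, h0⟩
  · exact Or.inr ⟨hv, h1⟩

theorem exists_strong_not_unbColorable {D : V → V → Prop} {Z1 Z2 : Set (V × V)} {S : Set V}
    {m : ℕ} (hm : 1 ≤ m) (hS : ¬ UnbColorable D Z1 Z2 S m) :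
    ∃ H ⊆ S, StronglyConnectedOn D H ∧ ¬ UnbColorable D Z1 Z2 H m := by
  by_contra! h
  let R := Relation.ReflTransGen (inducedRel D S)
  let κ : V → Set V := fun x => {v | R x v ∧ R v x}
  refine hS (unbColorable_glue κ (fun x hx => ?_) hm ?_)
  · refine h _ Set.inter_subset_left ?_
    rintro u ⟨huS, hu⟩ v ⟨-, hv⟩
    have huv : v ∈ κ u := by
      rw [show κ u = κ v from hu.trans hv.symm]; exact ⟨.refl, .refl⟩
    have key : ∀ w, R w v → R v w → w ∈ S → Relation.ReflTransGen
        (inducedRel D (S ∩ {v | κ v = κ x})) w v := by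
      intro w hw
      have class_eq : ∀ a, R a v → R v a → κ a = κ x := by
        intro a h1 h2
        refine Eq.trans ?_ hv
        ext b
        exact ⟨fun hb => ⟨h2.trans hb.1, hb.2.trans h1⟩,
          fun hb => ⟨h1.trans hb.1, hb.2.trans h2⟩⟩
      induction hw using Relation.ReflTransGen.head_induction_on with
      | refl => exact fun _ _ => .refl
      | @head a c hac hcv ih =>
        intro hva haS
        have hvc : R v c := hva.tail hac
        refine (ih hvc hac.2.2).head ⟨hac.1, ⟨haS, class_eq a (hcv.head hac) hva⟩,
          ⟨hac.2.2, class_eq c hcv hvc⟩⟩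
    exact key u huv.1 huv.2 huS
  · intro vs hvs hvS x hx y hy
    have key : ∀ a ∈ vs, ∀ b ∈ vs, R a b := fun a ha b hb =>
      Relation.ReflTransGen.mono (fun p q hpq => ⟨hvs.2.2 _ hpq,
        hvS _ (mem_of_mem_cycleArcs hpq).1, hvS _ (mem_of_mem_cycleArcs hpq).2⟩)
        _ _ (cycleArcs_connected ha hb)
    ext b
    exact ⟨fun hb => ⟨(key y hy x hx).trans hb.1, hb.2.trans (key x hx y hy)⟩,
      fun hb => ⟨(key x hx y hy).trans hb.1, hb.2.trans (key y hy x hx)⟩⟩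

/-- A set of large unbalanced dichromatic number contains a strong set `T` whose removal
lowers that number only by a prescribed amount. -/
theorem exists_strong_split [Finite V] {D : V → V → Prop} {Z1 Z2 : Set (V × V)} {S : Set V}
    {m n : ℕ} (hloop : ∀ v, UnbColorable D Z1 Z2 {v} 1) (hm : 1 ≤ m)
    (hS : ¬ UnbColorable D Z1 Z2 S (m + n + 1)) :
    ∃ T ⊆ S, StronglyConnectedOn D T ∧ ¬ UnbColorable D Z1 Z2 T m ∧
      ¬ UnbColorable D Z1 Z2 (S \ T) n := by
  have hS' : ¬ UnbColorable D Z1 Z2 S m := fun h => hS (h.mono (by omega))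
  obtain ⟨T, hTS, hT⟩ := (Set.toFinite {A | ¬ UnbColorable D Z1 Z2 A m}).exists_le_minimal hS'
  obtain ⟨H, hHT, hH, hHm⟩ := exists_strong_not_unbColorable hm hT.1
  obtain rfl : H = T := hT.eq_of_subset hHm hHT
  refine ⟨H, hTS, hH, hHm, fun hn => hS ?_⟩
  obtain ⟨x, hx⟩ : H.Nonempty := by
    by_contra hne
    rw [Set.not_nonempty_iff_eq_empty] at hne
    exact hHm (hne ▸ unbColorable_empty D Z1 Z2 hm)
  have hdel : UnbColorable D Z1 Z2 (H \ {x}) m := by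
    by_contra hcon
    have hx' : x ∈ H \ {x} := (hT.eq_of_subset hcon Set.sdiff_subset).symm ▸ hx
    exact hx'.2 rfl
  refine (((hdel.union (hloop x)).union hn).mono (by omega)).subset fun v hv => ?_
  by_cases hvH : v ∈ H
  · by_cases hvx : v = x <;> simp_all
  · simp_all

/-- A colouring of a set with too few colours has a monochromatic arc on which membership in
`Z1` and `Z2` differs. -/
theorem exists_bad_arc {D : V → V → Prop} {Z1 Z2 : Set (V × V)} {S : Set V} {α : Type*}
    [Fintype α] (z : V → α) {m : ℕ} (hm : Fintype.card α ≤ m)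
    (hS : ¬ UnbColorable D Z1 Z2 S m) :
    ∃ s ∈ S, ∃ t ∈ S, D s t ∧ z s = z t ∧ ¬ ((s, t) ∈ Z1 ↔ (s, t) ∈ Z2) := by
  by_contra! h
  refine hS (unbColorable_of_coloring z (fun i vs hvs hvS hunb => hunb ?_) hm)
  have hiff : ∀ p ∈ cycleArcs vs, (p ∈ Z1 ↔ p ∈ Z2) := by
    intro p hp
    obtain ⟨h1, h2⟩ := mem_of_mem_cycleArcs hp
    exact h _ (hvS _ h1).1 _ (hvS _ h2).1 (hvs.2.2 p hp)
      ((hvS _ h1).2.trans (hvS _ h2).2.symm)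
  exact congrArg (fun P : V × V → Prop => Nat.card {a // P a})
    (funext fun a => propext (and_congr_right (hiff a)))

end UnbalancedColouring

section Paths

variable {G : Type*} [AddCommMonoid G]

/-- Some directed path of `D` from `u` to `v` with all vertices in `A` has total `F`-weight
`g`. -/
def HasPath (D : V → V → Prop) (F : V → V → G) (A : Set V) (u v : V) (g : G) : Prop :=
  ∃ vs : List V, IsDipathFromTo D vs u v ∧ (∀ x ∈ vs, x ∈ A) ∧
    ((pathArcs vs).map fun p => F p.1 p.2).sum = g

theorem HasPath.mono {D : V → V → Prop} {F : V → V → G} {A B : Set V} {u v : V} {g : G}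
    (h : HasPath D F A u v g) (hAB : A ⊆ B) : HasPath D F B u v g := by
  obtain ⟨vs, h1, h2, h3⟩ := h
  exact ⟨vs, h1, fun x hx => hAB (h2 x hx), h3⟩

theorem hasPath_refl (D : V → V → Prop) (F : V → V → G) (u : V) : HasPath D F {u} u u 0 :=
  ⟨[u], ⟨⟨by simp, List.isChain_singleton _⟩, rfl, rfl⟩, by simp, by simp [pathArcs]⟩

theorem hasPath_arc {D : V → V → Prop} (F : V → V → G) {u v : V} (h : D u v) (huv : u ≠ v) :
    HasPath D F {u, v} u v (F u v) :=
  ⟨[u, v], ⟨⟨by simpa using huv, List.isChain_pair.2 h⟩, rfl, rfl⟩, by simp,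
    by simp [pathArcs]⟩

theorem pathArcs_append (l l' : List V) (v : V) :
    pathArcs (l ++ v :: l') = pathArcs (l ++ [v]) ++ pathArcs (v :: l') := by
  induction l with
  | nil => simp [pathArcs]
  | cons a l ih =>
    cases l with
    | nil => simp [pathArcs]
    | cons b l => simpa [pathArcs] using ih

theorem HasPath.trans {D : V → V → Prop} {F : V → V → G} {A B : Set V} {u v w : V} {g h : G}
    (huv : HasPath D F A u v g) (hvw : HasPath D F B v w h)
    (hAB : ∀ x ∈ A, x ∈ B → x = v) : HasPath D F (A ∪ B) u w (g + h) := by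
  obtain ⟨p, ⟨⟨hp1, hp2⟩, hp3, hp4⟩, hpA, rfl⟩ := huv
  obtain ⟨p', ⟨⟨hq1, hq2⟩, hq3, hq4⟩, hqB, rfl⟩ := hvw
  obtain ⟨l, rfl⟩ := List.getLast?_eq_some_iff.1 hp4
  obtain ⟨l', rfl⟩ := List.head?_eq_some_iff.1 hq3
  refine ⟨l ++ v :: l', ⟨⟨?_, ?_⟩, ?_, ?_⟩, ?_, ?_⟩
  · rw [List.nodup_append] at hp1 ⊢
    refine ⟨hp1.1, hq1, fun a ha b hb hab => ?_⟩
    subst hab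
    have := hAB a (hpA a (by simp [ha])) (hqB a hb)
    exact hp1.2.2 a ha v (by simp) this
  · exact List.isChain_split.2 ⟨hp2, hq2⟩
  · cases l <;> simpa using hp3
  · simpa using hq4
  · intro x hx
    rcases List.mem_append.1 hx with hx | hx
    · exact Or.inl (hpA x (by simp [hx]))
    · exact Or.inr (hqB x hx)
  · rw [pathArcs_append, List.map_append, List.sum_append]

theorem HasPath.reflTransGen {D : V → V → Prop} {F : V → V → G} {A : Set V} {u v : V} {g : G}
    (h : HasPath D F A u v g) : Relation.ReflTransGen (inducedRel D A) u v := by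
  obtain ⟨vs, ⟨⟨-, hc⟩, hh, hl⟩, hA, -⟩ := h
  change vs.IsChain D at hc
  induction vs generalizing u with
  | nil => simp at hh
  | cons a l ih =>
    obtain rfl : a = u := by simpa using hh
    cases l with
    | nil => obtain rfl : a = v := by simpa using hl
             exact .refl
    | cons b l =>
      rw [List.isChain_cons_cons] at hc
      exact (ih rfl (by simpa using hl) (fun x hx => hA x (by simp [hx])) hc.2).head
        ⟨hc.1, hA a (by simp), hA b (by simp)⟩

/-- The vertices reached from `T` by exactly `n` steps of `R`. -/
def stepsFrom (R : V → V → Prop) (T : Set V) : ℕ → Set V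
  | 0 => T
  | n + 1 => {v | ∃ u ∈ stepsFrom R T n, R u v}

/-- Breadth-first search from `T` in the relation `R`, restricted to a set `H` closed under
`R` that is reachable from `T`. -/
theorem exists_bfs (R : V → V → Prop) (T H : Set V) (hTH : T ⊆ H)
    (hclosed : ∀ u ∈ H, ∀ v, R u v → v ∈ H)
    (hreach : ∀ v ∈ H, ∃ t ∈ T, Relation.ReflTransGen R t v) :
    ∃ d : V → ℕ, (∀ v ∈ T, d v = 0) ∧
      (∀ v ∈ H, v ∉ T → ∃ u ∈ H, R u v ∧ d v = d u + 1) ∧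
      ∀ u ∈ H, ∀ v, R u v → d v ≤ d u + 1 := by
  have hsteps : ∀ v ∈ H, ∃ n, v ∈ stepsFrom R T n := by
    intro v hv
    obtain ⟨t, ht, h⟩ := hreach v hv
    clear hv
    induction h with
    | refl => exact ⟨0, ht⟩
    | tail _ h ih => exact ih.elim fun n hn => ⟨n + 1, _, hn, h⟩
  have hsub : ∀ n, stepsFrom R T n ⊆ H := by
    intro n
    induction n with
    | zero => exact hTH
    | succ n ih => rintro v ⟨u, hu, huv⟩; exact hclosed u (ih hu) v huv
  let d : V → ℕ := fun v => sInf {n | v ∈ stepsFrom R T n}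
  have hmem : ∀ v ∈ H, v ∈ stepsFrom R T (d v) := fun v hv => Nat.sInf_mem (hsteps v hv)
  have hle : ∀ v n, v ∈ stepsFrom R T n → d v ≤ n := fun v n hn => Nat.sInf_le hn
  have harc : ∀ u ∈ H, ∀ v, R u v → d v ≤ d u + 1 :=
    fun u hu v huv => hle v _ ⟨u, hmem u hu, huv⟩
  refine ⟨d, fun v hv => Nat.le_zero.1 (hle v 0 hv), fun v hv hvT => ?_, harc⟩
  have h := hmem v hv
  cases hn : d v with
  | zero => rw [hn] at h; exact absurd h hvT
  | succ n =>
    rw [hn] at h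
    obtain ⟨u, hu, huv⟩ := h
    have h1 := hle u n hu
    have h2 := harc u (hsub n hu) v huv
    exact ⟨u, hsub n hu, huv, by omega⟩

theorem StronglyConnectedOn.exists_out_bfs {D : V → V → Prop} {H : Set V} {k : V}
    (hH : StronglyConnectedOn D H) (hk : k ∈ H) :
    ∃ d : V → ℕ, d k = 0 ∧ (∀ v ∈ H, v ≠ k → ∃ u ∈ H, D u v ∧ d v = d u + 1) ∧
      ∀ u ∈ H, ∀ v ∈ H, D u v → d v ≤ d u + 1 := by
  obtain ⟨d, h1, h2, h3⟩ := exists_bfs (inducedRel D H) {k} H (by simpa using hk)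
    (fun u _ v h => h.2.2) (fun v hv => ⟨k, rfl, hH k hk v hv⟩)
  refine ⟨d, h1 k rfl, fun v hv hvk => ?_, fun u hu v hv h => h3 u hu v ⟨h, hu, hv⟩⟩
  obtain ⟨u, hu, huv, hd⟩ := h2 v hv hvk
  exact ⟨u, hu, huv.1, hd⟩

theorem StronglyConnectedOn.exists_in_bfs {D : V → V → Prop} {H T : Set V}
    (hH : StronglyConnectedOn D H) (hT : T.Nonempty) (hTH : T ⊆ H) :
    ∃ d : V → ℕ, (∀ v ∈ T, d v = 0) ∧
      (∀ v ∈ H, v ∉ T → ∃ u ∈ H, D v u ∧ d v = d u + 1) ∧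
      ∀ u ∈ H, ∀ v ∈ H, D u v → d u ≤ d v + 1 := by
  obtain ⟨t, ht⟩ := hT
  obtain ⟨d, h1, h2, h3⟩ := exists_bfs (fun a b => inducedRel D H b a) T H hTH
    (fun u _ v h => h.2.1)
    (fun v hv => ⟨t, ht, Relation.reflTransGen_swap.1 (hH v hv t (hTH ht))⟩)
  refine ⟨d, h1, fun v hv hvk => ?_, fun u hu v hv h => h3 v hv u ⟨h, hu, hv⟩⟩
  obtain ⟨u, hu, huv, hd⟩ := h2 v hv hvk
  exact ⟨u, hu, huv.1, hd⟩

theorem exists_hasPath_from_root {D : V → V → Prop} (F : V → V → G) {H : Set V} {k : V}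
    {d : V → ℕ} (hk : k ∈ H)
    (hd : ∀ v ∈ H, v ≠ k → ∃ u ∈ H, D u v ∧ d v = d u + 1) {v : V} (hv : v ∈ H) :
    ∃ g, HasPath D F {x | x ∈ H ∧ (d x < d v ∨ x = v)} k v g := by
  induction hn : d v generalizing v with
  | zero =>
    obtain rfl : v = k := by
      by_contra h
      obtain ⟨u, -, -, hu⟩ := hd v hv h
      omega
    exact ⟨0, (hasPath_refl D F v).mono (by simp [hk])⟩
  | succ n ih =>
    by_cases hvk : v = k
    · subst hvk
      exact ⟨0, (hasPath_refl D F v).mono (by simp [hk])⟩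
    obtain ⟨u, hu, huv, hdu⟩ := hd v hv hvk
    obtain ⟨g, hg⟩ := ih hu (by omega)
    have hne : u ≠ v := by rintro rfl; omega
    refine ⟨_, (hg.trans (hasPath_arc F huv hne) ?_).mono ?_⟩
    · rintro x ⟨-, hx⟩ (rfl | rfl)
      · rfl
      · rcases hx with hx | hx
        · omega
        · exact hx
    · rintro x (⟨hxH, hx⟩ | rfl | rfl)
      · refine ⟨hxH, Or.inl ?_⟩
        rcases hx with hx | rfl <;> omega
      · exact ⟨hu, Or.inl (by omega)⟩
      · exact ⟨hv, Or.inr rfl⟩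

theorem exists_hasPath_to_set {D : V → V → Prop} (F : V → V → G) {H T : Set V}
    {d : V → ℕ} (hd : ∀ v ∈ H, v ∉ T → ∃ u ∈ H, D v u ∧ d v = d u + 1)
    (hdT : ∀ v ∈ T, d v = 0) {v : V} (hv : v ∈ H) :
    ∃ t ∈ T, ∃ g, HasPath D F {x | x ∈ H ∧ (d x < d v ∨ x = v) ∧ (x ∈ T → x = t)} v t g := by
  induction hn : d v generalizing v with
  | zero =>
    have hvT : v ∈ T := by
      by_contra h
      obtain ⟨u, -, -, hu⟩ := hd v hv h
      omega
    exact ⟨v, hvT, 0, (hasPath_refl D F v).mono (by simp [hv])⟩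
  | succ n ih =>
    have hvT : v ∉ T := fun h => by have := hdT v h; omega
    obtain ⟨u, hu, huv, hdu⟩ := hd v hv hvT
    obtain ⟨t, ht, g, hg⟩ := ih hu (by omega)
    have hne : v ≠ u := by rintro rfl; omega
    refine ⟨t, ht, _, ((hasPath_arc F huv hne).trans hg ?_).mono ?_⟩
    · rintro x (rfl | rfl) ⟨-, hx, -⟩
      · rcases hx with hx | hx
        · omega
        · exact hx
      · rfl
    · rintro x ((rfl | rfl) | ⟨hxH, hx, hxT⟩)
      · exact ⟨hv, Or.inr rfl, fun h => absurd h hvT⟩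
      · refine ⟨hu, Or.inl (by omega), fun h => ?_⟩
        obtain ⟨vs, ⟨-, hh, -⟩, hA, -⟩ := hg
        exact (hA x (List.mem_of_mem_head? hh)).2.2 h
      · refine ⟨hxH, Or.inl ?_, hxT⟩
        rcases hx with hx | rfl <;> omega

theorem exists_hasPath_of_reflTransGen {D : V → V → Prop} (F : V → V → G) {A : Set V}
    {u v : V} (hu : u ∈ A) (h : Relation.ReflTransGen (inducedRel D A) u v) :
    ∃ g, HasPath D F A u v g := by
  let H : Set V := {x | Relation.ReflTransGen (inducedRel D A) u x}
  have hHA : H ⊆ A := by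
    intro x hx
    rcases Relation.ReflTransGen.cases_tail hx with rfl | ⟨y, -, hy⟩
    · exact hu
    · exact hy.2.2
  have huH : u ∈ H := .refl
  obtain ⟨d, -, h2, -⟩ := exists_bfs (inducedRel D A) {u} H (by simpa using huH)
    (fun x hx y hxy => Relation.ReflTransGen.tail hx hxy) (fun x hx => ⟨u, rfl, hx⟩)
  have hd : ∀ x ∈ H, x ≠ u → ∃ y ∈ H, D y x ∧ d x = d y + 1 := by
    intro x hx hxu
    obtain ⟨y, hy, hyx, hdy⟩ := h2 x hx hxu
    exact ⟨y, hy, hyx.1, hdy⟩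
  obtain ⟨g, hg⟩ := exists_hasPath_from_root F huH hd (show v ∈ H from h)
  exact ⟨g, hg.mono fun x hx => hHA hx.1⟩

end Paths

section Gadgets

/-- The indicators of `Z1` and `Z2` on an arc, modulo `q`. -/
noncomputable def arcWeight (q : ℕ) (Z1 Z2 : Set (V × V)) (u v : V) : ZMod q × ZMod q :=
  (Z1.indicator 1 (u, v), Z2.indicator 1 (u, v))

theorem arcCount_eq_sum (q : ℕ) {l : List (V × V)} (hl : l.Nodup) (Z : Set (V × V)) :
    (arcCount l Z : ZMod q) = (l.map (Z.indicator 1)).sum := by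
  classical
  have h1 : arcCount l Z = (l.filter (· ∈ Z)).length := by
    rw [← List.toFinset_card_of_nodup (hl.filter _), arcCount]
    exact Nat.subtype_card _ (by simp)
  rw [h1]
  clear h1 hl
  induction l with
  | nil => simp
  | cons a l ih => by_cases h : a ∈ Z <;> simp [h, ih, add_comm]

theorem pathArcs_nodup {vs : List V} (h : vs.Nodup) : (pathArcs vs).Nodup := by
  refine List.Nodup.of_map Prod.snd ?_
  rw [pathArcs, List.map_snd_zip (by simp)]
  exact h.tail

theorem sum_arcWeight (q : ℕ) (Z1 Z2 : Set (V × V)) {vs : List V} (h : vs.Nodup) :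
    ((pathArcs vs).map fun p => arcWeight q Z1 Z2 p.1 p.2).sum =
      ((arcCount (pathArcs vs) Z1 : ZMod q), (arcCount (pathArcs vs) Z2 : ZMod q)) := by
  rw [arcCount_eq_sum q (pathArcs_nodup h), arcCount_eq_sum q (pathArcs_nodup h)]
  induction pathArcs vs with
  | nil => rfl
  | cons a l ih => rw [List.map_cons, List.sum_cons, ih]; simp [arcWeight]

theorem mem_iff_mem_of_loop {D : V → V → Prop} {Z1 Z2 : Set (V × V)} {v : V}
    (hloop : UnbColorable D Z1 Z2 {v} 1) (hv : D v v) : (v, v) ∈ Z1 ↔ (v, v) ∈ Z2 := by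
  obtain ⟨c, hc⟩ := hloop
  have h := hc (c v) [v] ⟨by simp, by simp, by simpa [cycleArcs] using hv⟩ (by simp)
  rw [Unbalanced, not_not] at h
  have hnd : (cycleArcs [v]).Nodup := by simp [cycleArcs]
  have h0 := congrArg (Nat.cast : ℕ → ZMod 0) h
  rw [arcCount_eq_sum 0 hnd, arcCount_eq_sum 0 hnd] at h0
  by_cases h1 : (v, v) ∈ Z1 <;> by_cases h2 : (v, v) ∈ Z2 <;> simp_all [cycleArcs]

theorem ncard_lt_of_shifts {q : ℕ} [NeZero q] {P P' : Set (ZMod q)} {c e : ZMod q} {n : ℕ}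
    (he : IsUnit e) (hn : n ≤ P.ncard) (hn0 : 1 ≤ n) (hnq : n + 1 ≤ q)
    (h : ∀ x ∈ P, x + c ∈ P' ∧ x + c + e ∈ P') : n + 1 ≤ P'.ncard := by
  by_contra! hlt
  have hsub : (· + c) '' P ⊆ P' := by
    rintro _ ⟨x, hx, rfl⟩; exact (h x hx).1
  have heq : (· + c) '' P = P' := by
    refine Set.eq_of_subset_of_ncard_le hsub ?_ (Set.toFinite _)
    rw [Set.ncard_image_of_injective _ (add_left_injective c)]
    omega
  have hclosed : ∀ y ∈ P', y + e ∈ P' := by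
    rw [← heq]
    rintro _ ⟨x, hx, rfl⟩
    rw [heq]; exact (h x hx).2
  obtain ⟨x, hx⟩ : P.Nonempty := by
    rw [← Set.ncard_pos (Set.toFinite _)]; omega
  have hmul : ∀ j : ℕ, x + c + j * e ∈ P' := by
    intro j
    induction j with
    | zero => simpa using (h x hx).1
    | succ j ih => have := hclosed _ ih; push_cast; rwa [add_mul, one_mul, ← add_assoc]
  have huniv : P' = Set.univ := by
    refine Set.eq_univ_of_forall fun y => ?_
    obtain ⟨e, rfl⟩ := he
    have := hmul ((y - (x + c)) * ↑e⁻¹ : ZMod q).val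
    rw [ZMod.natCast_zmod_val, mul_assoc, Units.inv_mul, mul_one] at this
    simpa using this
  rw [huniv, Set.ncard_univ, Nat.card_zmod] at hlt
  omega

/-- For each `u ∈ H` other than `k`, and all units `a` and `b`, the directed paths from `u` to
`k` internally disjoint from `H` realise at least `n` values `a * |Z1| + b * |Z2|` mod `q`. -/
def RichTerminal (D : V → V → Prop) (Z1 Z2 : Set (V × V)) (q : ℕ) (H : Set V) (k : V)
    (n : ℕ) : Prop :=
  ∀ u ∈ H, u ≠ k → ∀ a b : ZMod q, IsUnit a → IsUnit b →
    n ≤ {x | ∃ g, HasPath D (arcWeight q Z1 Z2) (Hᶜ ∪ {u, k}) u k g ∧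
      a * g.1 + b * g.2 = x}.ncard

theorem exists_richTerminal_one [Nonempty V] {D : V → V → Prop} {Z1 Z2 : Set (V × V)} {q m : ℕ}
    [NeZero q] (hD : StronglyConnectedOn D Set.univ) (hm : 1 ≤ m)
    (hmu : ¬ UnbColorable D Z1 Z2 Set.univ (2 * m)) :
    ∃ H k, StronglyConnectedOn D H ∧ k ∈ H ∧ RichTerminal D Z1 Z2 q H k 1 ∧
      ¬ UnbColorable D Z1 Z2 H m := by
  obtain ⟨r⟩ := ‹Nonempty V›
  obtain ⟨d, hd0, hdpar, hdarc⟩ :=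
    hD.exists_in_bfs (Set.singleton_nonempty r) (Set.subset_univ _)
  obtain ⟨j, hj⟩ := exists_level_not_unbColorable hm (Or.inr hdarc) hmu
  obtain ⟨H, hHj, hH, hHm⟩ := exists_strong_not_unbColorable hm hj
  have hne : H.Nonempty := by
    by_contra hne
    rw [Set.not_nonempty_iff_eq_empty] at hne
    exact hHm (hne ▸ unbColorable_empty D Z1 Z2 hm)
  obtain ⟨e, he0, hepar, -⟩ := hD.exists_in_bfs hne (Set.subset_univ _)
  obtain ⟨k, hk, g, hg⟩ :=
    exists_hasPath_to_set (arcWeight q Z1 Z2) hepar he0 (Set.mem_univ r)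
  refine ⟨H, k, hH, hk, fun u hu huk a b _ _ => ?_, hHm⟩
  obtain ⟨r', rfl, g', hg'⟩ :=
    exists_hasPath_to_set (arcWeight q Z1 Z2) hdpar hd0 (Set.mem_univ u)
  have h1 : HasPath D (arcWeight q Z1 Z2) (Hᶜ ∪ {u, k}) u r' g' := by
    refine hg'.mono ?_
    rintro x ⟨-, hx | rfl, -⟩
    · refine Or.inl fun hxH => ?_
      have h2 : d x = j := (hHj hxH).2
      have h3 : d u = j := (hHj hu).2
      omega
    · simp
  have h2 : HasPath D (arcWeight q Z1 Z2) (Hᶜ ∪ {u, k}) r' k g := by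
    refine hg.mono ?_
    rintro x ⟨-, -, hx⟩
    by_cases hxH : x ∈ H
    · simp [hx hxH]
    · exact Or.inl hxH
  obtain ⟨w, hw⟩ := exists_hasPath_of_reflTransGen (arcWeight q Z1 Z2) (A := Hᶜ ∪ {u, k})
    (by simp) (h1.reflTransGen.trans h2.reflTransGen)
  exact (Set.ncard_pos (Set.toFinite _)).2 ⟨_, w, hw, rfl⟩

theorem RichTerminal.exists_succ [Finite V] {D : V → V → Prop} {Z1 Z2 : Set (V × V)}
    {q n m : ℕ} [NeZero q] {H : Set V} {k : V}
    (hloop : ∀ v, UnbColorable D Z1 Z2 {v} 1)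
    (hH : StronglyConnectedOn D H) (hk : k ∈ H) (hrich : RichTerminal D Z1 Z2 q H k n)
    (hn : 1 ≤ n) (hnq : n + 1 ≤ q) (hm : 1 ≤ m)
    (hmu : ¬ UnbColorable D Z1 Z2 H (2 * (m + 2 * q ^ 2 + 1))) :
    ∃ T t, StronglyConnectedOn D T ∧ t ∈ T ∧ RichTerminal D Z1 Z2 q T t (n + 1) ∧
      ¬ UnbColorable D Z1 Z2 T m := by
  have hq : 1 ≤ q ^ 2 := Nat.one_le_pow _ _ (by omega)
  obtain ⟨d, hd0, hdpar, hdarc⟩ := hH.exists_out_bfs hk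
  obtain ⟨j, hj⟩ := exists_level_not_unbColorable (by omega) (Or.inl hdarc) hmu
  obtain ⟨K, hKj, hK, hKm⟩ := exists_strong_not_unbColorable (by omega) hj
  obtain ⟨T, hTK, hT, hTm, hKT⟩ := exists_strong_split hloop hm hKm
  have hTne : T.Nonempty := by
    by_contra hne
    rw [Set.not_nonempty_iff_eq_empty] at hne
    exact hTm (hne ▸ unbColorable_empty D Z1 Z2 hm)
  obtain ⟨e, he0, hepar, hearc⟩ := hK.exists_in_bfs hTne hTK
  obtain ⟨i, hi⟩ := exists_level_not_unbColorable hq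
    (Or.inr fun u hu v hv => hearc u hu.1 v hv.1) hKT
  choose! z hz using fun v hv => exists_hasPath_from_root (arcWeight q Z1 Z2) hk hdpar (v := v) hv
  obtain ⟨s, ⟨⟨hsK, hsT⟩, hsi⟩, t, ⟨⟨htK, htT⟩, hti⟩, hst, hzst, hbad⟩ :=
    exists_bad_arc z (by simp [ZMod.card, sq]) hi
  have hne : s ≠ t := by
    rintro rfl
    exact hbad (mem_iff_mem_of_loop (hloop s) hst)
  have hdj : ∀ x ∈ K, d x = j := fun x hx => (hKj hx).2
  have hKH : ∀ x ∈ K, x ∈ H := fun x hx => (hKj hx).1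
  simp only [Set.mem_ofPred_eq] at hsi hti
  have hkK : k ∉ K := by
    intro hkK
    have eq_k : ∀ v ∈ K, v = k := by
      intro v hv
      by_contra hvk
      obtain ⟨u, -, -, hu⟩ := hdpar v (hKH v hv) hvk
      have := hdj v hv
      have := hdj k hkK
      omega
    exact hne ((eq_k s hsK).trans (eq_k t htK).symm)
  obtain ⟨t', ht', w, hw⟩ := exists_hasPath_to_set (arcWeight q Z1 Z2) hepar he0 htK
  refine ⟨T, t', hT, ht', fun u hu hut a b ha hb => ?_, hTm⟩
  have huk : u ≠ k := fun h => hkK (h ▸ hTK hu)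
  refine ncard_lt_of_shifts (c := a * (z t + w).1 + b * (z t + w).2)
    (e := a * (arcWeight q Z1 Z2 s t).1 + b * (arcWeight q Z1 Z2 s t).2) ?_
    (hrich u (hKH u (hTK hu)) huk a b ha hb) hn hnq ?_
  · by_cases h1 : (s, t) ∈ Z1 <;> by_cases h2 : (s, t) ∈ Z2 <;> simp_all [arcWeight]
  have extend : ∀ g y, HasPath D (arcWeight q Z1 Z2) (Hᶜ ∪ {u, k}) u k g →
      HasPath D (arcWeight q Z1 Z2) {x | x ∈ H ∧ (d x < j ∨ x = s ∨ x = t)} k t y →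
      HasPath D (arcWeight q Z1 Z2) (Tᶜ ∪ {u, t'}) u t' (g + y + w) := by
    intro g y hg hy
    refine ((hg.trans hy ?_).trans hw ?_).mono ?_
    · rintro x (hx | rfl | rfl) ⟨hxH, hx'⟩
      · exact absurd hxH hx
      · have h1 := hdj x (hTK hu)
        rcases hx' with hx' | rfl | rfl
        · omega
        · exact absurd hu hsT
        · exact absurd hu htT
      · rfl
    · rintro x hx ⟨hxK, hx1, hx2⟩
      rcases hx with (hx | rfl | rfl) | ⟨-, hx | rfl | rfl⟩
      · exact absurd (hKH x hxK) hx
      · exact absurd (hx2 hu) hut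
      · exact absurd hxK hkK
      · have := hdj x hxK; omega
      · rcases hx1 with hx1 | hx1
        · omega
        · exact hx1
      · rfl
    · rintro x (((hx | rfl | rfl) | ⟨-, hx | rfl | rfl⟩) | ⟨hxK, hx1, hx2⟩)
      · exact Or.inl fun hxT => hx (hKH x (hTK hxT))
      · simp
      · exact Or.inl fun hxT => hkK (hTK hxT)
      · exact Or.inl fun hxT => by have := hdj x (hTK hxT); omega
      · exact Or.inl hsT
      · exact Or.inl htT
      · by_cases hxT : x ∈ T
        · simp [hx2 hxT]
        · exact Or.inl hxT
  have direct : HasPath D (arcWeight q Z1 Z2) {x | x ∈ H ∧ (d x < j ∨ x = s ∨ x = t)} k t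
      (z t) := by
    refine (hz t (hKH t htK)).mono ?_
    rintro x ⟨hxH, hx | rfl⟩
    · exact ⟨hxH, Or.inl (hdj t htK ▸ hx)⟩
    · exact ⟨hxH, Or.inr (Or.inr rfl)⟩
  have detour : HasPath D (arcWeight q Z1 Z2) {x | x ∈ H ∧ (d x < j ∨ x = s ∨ x = t)} k t
      (z s + arcWeight q Z1 Z2 s t) := by
    refine ((hz s (hKH s hsK)).trans (hasPath_arc _ hst hne) ?_).mono ?_
    · rintro x ⟨-, hx⟩ (rfl | rfl)
      · rfl
      · rcases hx with hx | hx
        · have := hdj x htK; have := hdj s hsK; omega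
        · exact hx
    · rintro x (⟨hxH, hx | rfl⟩ | rfl | rfl)
      · exact ⟨hxH, Or.inl (hdj s hsK ▸ hx)⟩
      · exact ⟨hxH, Or.inr (Or.inl rfl)⟩
      · exact ⟨hKH x hsK, Or.inr (Or.inl rfl)⟩
      · exact ⟨hKH x htK, Or.inr (Or.inr rfl)⟩
  rintro _ ⟨g, hg, rfl⟩
  refine ⟨⟨_, extend g _ hg direct, ?_⟩, ⟨_, extend g _ hg detour, ?_⟩⟩
  · simp only [Prod.fst_add, Prod.snd_add]; ring
  · rw [hzst]; simp only [Prod.fst_add, Prod.snd_add]; ring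

theorem RichTerminal.exists_add [Finite V] {D : V → V → Prop} {Z1 Z2 : Set (V × V)}
    {q : ℕ} [NeZero q] (hloop : ∀ v, UnbColorable D Z1 Z2 {v} 1) {M : ℕ} (hM : 1 ≤ M) (i : ℕ)
    {n L : ℕ} {H : Set V} {k : V} (hH : StronglyConnectedOn D H) (hk : k ∈ H)
    (hrich : RichTerminal D Z1 Z2 q H k n) (hn : 1 ≤ n) (hnq : n + i ≤ q)
    (hL : L + 2 * (2 * q ^ 2 + 1) = 2 ^ i * (M + 2 * (2 * q ^ 2 + 1)))
    (hmu : ¬ UnbColorable D Z1 Z2 H L) :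
    ∃ T t, StronglyConnectedOn D T ∧ t ∈ T ∧ RichTerminal D Z1 Z2 q T t (n + i) ∧
      ¬ UnbColorable D Z1 Z2 T M := by
  induction i generalizing n L H k with
  | zero =>
    obtain rfl : L = M := by omega
    exact ⟨H, k, hH, hk, hrich, hmu⟩
  | succ i ih =>
    have hpow : 1 * (M + 2 * (2 * q ^ 2 + 1)) ≤ 2 ^ i * (M + 2 * (2 * q ^ 2 + 1)) :=
      Nat.mul_le_mul_right _ Nat.one_le_two_pow
    obtain ⟨L', hL'⟩ : ∃ L', L' + 2 * (2 * q ^ 2 + 1) = 2 ^ i * (M + 2 * (2 * q ^ 2 + 1)) :=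
      ⟨_, Nat.sub_add_cancel (by omega)⟩
    have hLL' : L = 2 * (L' + 2 * q ^ 2 + 1) := by
      rw [pow_succ' 2 i, mul_assoc, ← hL'] at hL
      omega
    subst hLL'
    obtain ⟨T, t, hT, ht, hTrich, hTm⟩ :=
      hrich.exists_succ hloop hH hk hn (by omega) (by omega) hmu
    obtain ⟨T', t', h⟩ := ih hT ht hTrich (by omega) (by omega) hL' hTm
    rw [add_right_comm, add_assoc n i 1] at h
    exact ⟨T', t', h⟩

theorem List.Nodup.ne_of_mem_tail_dropLast {α : Type*} {l : List α} (hl : l.Nodup) {x u v : α}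
    (hu : l.head? = some u) (hv : l.getLast? = some v) (hx : x ∈ l.tail.dropLast) :
    x ≠ u ∧ x ≠ v := by
  refine ⟨?_, ?_⟩
  · rintro rfl
    obtain ⟨l', rfl⟩ := List.head?_eq_some_iff.1 hu
    exact (List.nodup_cons.1 hl).1 (List.mem_of_mem_dropLast hx)
  · rintro rfl
    obtain ⟨l', rfl⟩ := List.getLast?_eq_some_iff.1 hv
    rw [← List.tail_dropLast, List.dropLast_concat] at hx
    exact (List.nodup_append.1 hl).2.2 x (List.mem_of_mem_tail hx) x (by simp) rfl

/-- From a terminal realising all residues, a breadth-first search yields the set `X`. -/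
theorem RichTerminal.exists_xpaths [Finite V] {D : V → V → Prop} {Z1 Z2 : Set (V × V)}
    {q m : ℕ} [NeZero q] {T : Set V} {t : V} (hT : StronglyConnectedOn D T) (ht : t ∈ T)
    (hrich : RichTerminal D Z1 Z2 q T t q) (hm : 1 ≤ m)
    (hmu : ¬ UnbColorable D Z1 Z2 T (2 * m)) :
    ∃ X, ¬ UnbColorable D Z1 Z2 X m ∧ ∀ u ∈ X, ∀ v ∈ X, u ≠ v → ∀ a b l : ZMod q,
      IsUnit a → IsUnit b → ∃ Q, IsXPath D X Q u v ∧
        a * arcCount (pathArcs Q) Z1 + b * arcCount (pathArcs Q) Z2 = l := by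
  obtain ⟨d, hd0, hdpar, hdarc⟩ := hT.exists_out_bfs ht
  obtain ⟨j, hj⟩ := exists_level_not_unbColorable hm (Or.inl hdarc) hmu
  refine ⟨_, hj, fun u hu v hv huv a b l ha hb => ?_⟩
  have huj : d u = j := hu.2
  have hvj : d v = j := hv.2
  have hj0 : j ≠ 0 := by
    have eq_t : ∀ x ∈ T, d x = 0 → x = t := by
      intro x hx hdx
      by_contra hxt
      obtain ⟨y, -, -, hy⟩ := hdpar x hx hxt
      omega
    rintro rfl
    exact huv ((eq_t u hu.1 huj).trans (eq_t v hv.1 hvj).symm)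
  have hut : u ≠ t := by rintro rfl; omega
  obtain ⟨h, hh⟩ := exists_hasPath_from_root (arcWeight q Z1 Z2) ht hdpar hv.1
  have hall : {x | ∃ g, HasPath D (arcWeight q Z1 Z2) (Tᶜ ∪ {u, t}) u t g ∧
      a * g.1 + b * g.2 = x} = Set.univ := by
    refine Set.eq_of_subset_of_ncard_le (Set.subset_univ _) ?_ (Set.toFinite _)
    rw [Set.ncard_univ, Nat.card_zmod]
    exact hrich u hu.1 hut a b ha hb
  obtain ⟨g, hg, hgl⟩ := hall.ge (Set.mem_univ (l - (a * h.1 + b * h.2)))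
  obtain ⟨Q, hQ, hQA, hQsum⟩ := hg.trans hh (by
    rintro x (hx | rfl | rfl) ⟨hxT, hx'⟩
    · exact absurd hxT hx
    · rcases hx' with hx' | hx'
      · omega
      · exact absurd hx' huv
    · rfl)
  refine ⟨Q, ⟨hQ, hu, hv, huv, fun x hx hxX => ?_⟩, ?_⟩
  · obtain ⟨hxu, hxv⟩ := hQ.1.1.ne_of_mem_tail_dropLast hQ.2.1 hQ.2.2 hx
    have hxj : d x = j := hxX.2
    rcases hQA x (List.mem_of_mem_tail (List.mem_of_mem_dropLast hx)) with
      (hx | hx | hx) | ⟨-, hx | hx⟩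
    · exact hx hxX.1
    · exact hxu hx
    · rw [hx] at hxj; omega
    · omega
    · exact hxv hx
  · rw [sum_arcWeight q Z1 Z2 hQ.1.1, Prod.ext_iff] at hQsum
    obtain ⟨h1, h2⟩ := hQsum
    simp only [Prod.fst_add, Prod.snd_add] at h1 h2
    rw [h1, h2]
    linear_combination hgl

theorem unbColorable_threshold {q N : ℕ} (hq : 2 ≤ q) (hN : 2 ≤ N) :
    2 ^ q * (2 * (N - 1) + 2 * (2 * q ^ 2 + 1)) <
      2 ^ (2 * q - 2) * max (1536 * (q ^ 2 + 1)) (2 * N + 3072) - 6144 +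
        4 * (2 * q ^ 2 + 1) := by
  obtain ⟨N, rfl⟩ : ∃ N', N = N' + 1 := ⟨N - 1, by omega⟩
  rw [Nat.add_sub_cancel]
  have hA := le_max_left (1536 * (q ^ 2 + 1)) (2 * (N + 1) + 3072)
  have hB := le_max_right (1536 * (q ^ 2 + 1)) (2 * (N + 1) + 3072)
  generalize max (1536 * (q ^ 2 + 1)) (2 * (N + 1) + 3072) = M at *
  obtain ⟨r, rfl⟩ : ∃ r, q = r + 2 := ⟨q - 2, by omega⟩
  have e1 : 2 ^ (2 * (r + 2) - 2) = 4 * (2 ^ r * 2 ^ r) := by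
    rw [show 2 * (r + 2) - 2 = 2 + (r + r) by omega, pow_add, pow_add]; norm_num
  have e2 : 2 ^ (r + 2) = 4 * 2 ^ r := by rw [pow_add]; ring
  rw [e1, e2]
  rcases r with _ | r
  · omega
  · have hp : 2 ≤ 2 ^ (r + 1) := by
      rw [pow_succ]; have := Nat.one_le_two_pow (n := r); omega
    generalize 2 ^ (r + 1) = p at *
    generalize (r + 1 + 2) ^ 2 = Q at *
    have h1 : 2 * (p * M) ≤ p * p * M := by rw [mul_assoc p p M]; exact Nat.mul_le_mul_right _ hp
    have h2 : p * (1536 * (Q + 1)) + p * (2 * (N + 1) + 3072) ≤ 2 * (p * M) := by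
      have h : 1536 * (Q + 1) + (2 * (N + 1) + 3072) ≤ 2 * M := by linarith
      nlinarith [Nat.mul_le_mul_left p h]
    have h3 : 2 * (Q + 1) ≤ p * (Q + 1) := Nat.mul_le_mul_right _ hp
    have h4 : p * (1536 * (Q + 1)) = 1536 * (p * Q) + 1536 * p := by ring
    have h5 : p * (2 * (N + 1) + 3072) = 2 * (p * N) + 3074 * p := by ring
    have h6 : 4 * p * (2 * N + 2 * (2 * Q + 1)) = 8 * (p * N) + 16 * (p * Q) + 8 * p := by ring
    have h7 : 4 * (p * p) * M = 4 * (p * p * M) := by ring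
    rw [h6, h7]
    omega

end Gadgets

/-- (Proposition 4.3 of the paper.) There is a function `g` (one may take
`g q N = 2^(2q-2) * max (1536*(q²+1)) (2*N+3072) - 6144`) such that whenever `q, N ≥ 2`,
`D` is strongly connected and `μ(D,Z₁,Z₂) ≥ g q N`, there is `X ⊆ V(D)` with
`μ(D[X],Z₁,Z₂) ≥ N` such that for all distinct `u, v ∈ X` and all integers `a, b, ℓ` with
`gcd(a,q) = gcd(b,q) = 1`, there is a directed `X`-path `Q` from `u` to `v` with
`a·|A(Q)∩Z₁| + b·|A(Q)∩Z₂| ≡ ℓ (mod q)`. -/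
theorem stmt11 :
    ∃ g : ℕ → ℕ → ℕ,
      (∀ q N, g q N = 2 ^ (2 * q - 2) * max (1536 * (q ^ 2 + 1)) (2 * N + 3072) - 6144) ∧
      ∀ (q N : ℕ), 2 ≤ q → 2 ≤ N →
        ∀ (V : Type) [Fintype V] (D : V → V → Prop) (Z1 Z2 : Set (V × V)),
          StronglyConnectedOn D Set.univ → g q N ≤ mu D Z1 Z2 Set.univ →
          ∃ X : Set V, N ≤ mu D Z1 Z2 X ∧
            ∀ u ∈ X, ∀ v ∈ X, u ≠ v → ∀ a b l : ℤ,
              Int.gcd a (q : ℤ) = 1 → Int.gcd b (q : ℤ) = 1 →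
              ∃ Q : List V, IsXPath D X Q u v ∧
                a * (arcCount (pathArcs Q) Z1 : ℤ) + b * (arcCount (pathArcs Q) Z2 : ℤ)
                  ≡ l [ZMOD (q : ℤ)] := by
  refine ⟨_, fun q N => rfl, fun q N hq hN V _ D Z1 Z2 hD hmu => ?_⟩
  have : NeZero q := ⟨by omega⟩
  have hthr := unbColorable_threshold hq hN
  obtain ⟨L, hL⟩ : ∃ L, L + 2 * (2 * q ^ 2 + 1) =
      2 ^ (q - 1) * (2 * (N - 1) + 2 * (2 * q ^ 2 + 1)) := by
    refine ⟨_, Nat.sub_add_cancel ?_⟩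
    calc 2 * (2 * q ^ 2 + 1) ≤ 1 * (2 * (N - 1) + 2 * (2 * q ^ 2 + 1)) := by omega
      _ ≤ _ := Nat.mul_le_mul_right _ Nat.one_le_two_pow
  have hpow : 2 ^ q * (2 * (N - 1) + 2 * (2 * q ^ 2 + 1)) =
      2 * (L + 2 * (2 * q ^ 2 + 1)) := by
    rw [hL, ← mul_assoc, ← pow_succ', Nat.sub_add_cancel (by omega)]
  have hL1 : 1 ≤ L := by
    have : 1 * (2 * (N - 1) + 2 * (2 * q ^ 2 + 1)) ≤
        2 ^ (q - 1) * (2 * (N - 1) + 2 * (2 * q ^ 2 + 1)) :=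
      Nat.mul_le_mul_right _ Nat.one_le_two_pow
    omega
  have huniv : ¬ UnbColorable D Z1 Z2 Set.univ (2 * L) :=
    Nat.notMem_of_lt_sInf (lt_of_lt_of_le (by omega) hmu)
  obtain ⟨K, hK⟩ : ∃ K, UnbColorable D Z1 Z2 Set.univ K := by
    refine Nat.nonempty_of_pos_sInf (lt_of_lt_of_le (by omega) hmu)
  have hloop : ∀ v, UnbColorable D Z1 Z2 {v} 1 := by
    obtain ⟨c, hc⟩ := hK
    exact fun v => ⟨fun _ => 0, fun i => (hc (c v)).subset (by rintro x ⟨rfl, -⟩; simp)⟩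
  have : Nonempty V := by
    by_contra hV
    rw [not_nonempty_iff] at hV
    exact huniv (Set.univ_eq_empty_iff.2 hV ▸ unbColorable_empty D Z1 Z2 (by omega))
  obtain ⟨H, k, hH, hk, hrich, hHL⟩ := exists_richTerminal_one (q := q) hD hL1 huniv
  obtain ⟨T, t, hT, ht, hTrich, hTm⟩ :=
    hrich.exists_add hloop (M := 2 * (N - 1)) (by omega) (q - 1) hH hk le_rfl (by omega) hL hHL
  rw [Nat.add_sub_cancel' (by omega)] at hTrich
  obtain ⟨X, hX, hpaths⟩ := hTrich.exists_xpaths hT ht (by omega) hTm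
  refine ⟨X, ?_, fun u hu v hv huv a b l ha hb => ?_⟩
  · refine le_csInf ⟨K, hK.subset (Set.subset_univ _)⟩ fun n hn => ?_
    by_contra! hlt
    exact hX (UnbColorable.mono hn (by omega))
  · have isUnit_cast : ∀ c : ℤ, Int.gcd c q = 1 → IsUnit (c : ZMod q) := fun c hc =>
      (ZMod.coe_unitOfIsCoprime c (Int.isCoprime_iff_gcd_eq_one.2 hc)) ▸ Units.isUnit _
    obtain ⟨Q, hQ, hsum⟩ := hpaths u hu v hv huv a b l (isUnit_cast a ha) (isUnit_cast b hb)
    refine ⟨Q, hQ, (ZMod.intCast_eq_intCast_iff _ _ q).1 ?_⟩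
    push_cast
    exact hsum
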